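/- For a convex body C in R^n, the function θ ↦ |P_θ C| on the unit sphere extends to a norm on R^n: there exists a Borel measure μ on S^{n−1} such that |P_θ C| = ∫_{S^{n−1}} |⟨θ, φ⟩| dμ(φ) for every unit vector θ. -/

import Mathlib

open MeasureTheory
open scoped RealInnerProductSpace

lemma lintegral_abs_deriv_of_monotoneOn {u : ℝ → ℝ} {K : NNReal} {a b : ℝ}
    (hu : LipschitzWith K u) (hab : a ≤ b) (hm : MonotoneOn u (Set.Icc a b)) :
    ∫⁻ t in Set.Ioc a b, ENNReal.ofReal |deriv u t| = ENNReal.ofReal (u b - u a) := by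
  have hac : AbsolutelyContinuousOnInterval u a b :=
    hu.lipschitzOnWith.absolutelyContinuousOnInterval
  have hint : IntegrableOn (deriv u) (Set.Ioc a b) :=
    (intervalIntegrable_iff_integrableOn_Ioc_of_le hab).1 hac.intervalIntegrable_deriv
  have hnonneg : ∀ t ∈ Set.Ioo a b, 0 ≤ deriv u t := fun t ht => by
    rw [← derivWithin_of_mem_nhds (Icc_mem_nhds ht.1 ht.2)]
    exact hm.derivWithin_nonneg
  rw [← hac.integral_deriv_eq_sub, intervalIntegral.integral_of_le hab,
    ofReal_integral_eq_lintegral_ofReal hint]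
  · rw [restrict_Ioo_eq_restrict_Ioc.symm]
    exact setLIntegral_congr_fun measurableSet_Ioo fun t ht => by
      simp only [abs_of_nonneg (hnonneg t ht)]
  · rw [restrict_Ioo_eq_restrict_Ioc.symm]
    exact (ae_restrict_iff' measurableSet_Ioo).2 (.of_forall hnonneg)

lemma lintegral_abs_deriv_of_antitoneOn {u : ℝ → ℝ} {K : NNReal} {a b : ℝ}
    (hu : LipschitzWith K u) (hab : a ≤ b) (hm : AntitoneOn u (Set.Icc a b)) :
    ∫⁻ t in Set.Ioc a b, ENNReal.ofReal |deriv u t| = ENNReal.ofReal (u a - u b) := by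
  have h := lintegral_abs_deriv_of_monotoneOn (u := fun t => -u t) hu.neg hab
    (fun x hx y hy hxy => neg_le_neg (hm hx hy hxy))
  simp only [deriv.fun_neg, abs_neg] at h
  rw [h]
  congr 1
  ring

/-- Along a line, the total variation of a convex function over a bounded sublevel set is twice
the distance from the level to the minimum. -/
lemma lintegral_abs_deriv_sublevel {u : ℝ → ℝ} {K : NNReal} {t₀ r : ℝ}
    (hu : LipschitzWith K u) (hc : ConvexOn ℝ Set.univ u) (hmin : ∀ t, u t₀ ≤ u t)
    (hb : Bornology.IsBounded {t | u t ≤ r}) :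
    ∫⁻ t in {t | u t ≤ r}, ENNReal.ofReal |deriv u t| = 2 * ENNReal.ofReal (r - u t₀) := by
  rcases lt_or_ge r (u t₀) with h | h
  · have : {t | u t ≤ r} = ∅ := by
      ext t
      simpa using h.trans_le (hmin t)
    simp [this, ENNReal.ofReal_of_nonpos (sub_nonpos.2 h.le)]
  have hcl : IsClosed {t | u t ≤ r} := isClosed_le hu.continuous continuous_const
  have hcomp : IsCompact {t | u t ≤ r} := Metric.isCompact_of_isClosed_isBounded hcl hb
  have hconn : IsConnected {t | u t ≤ r} :=
    ⟨⟨t₀, h⟩, by simpa using (hc.convex_le r).isPreconnected⟩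
  obtain ⟨a, b, hab⟩ : ∃ a b, {t | u t ≤ r} = Set.Icc a b :=
    ⟨_, _, eq_Icc_of_connected_compact hconn hcomp⟩
  have hmem : ∀ t, u t ≤ r ↔ a ≤ t ∧ t ≤ b := fun t => by
    simpa using congrArg (t ∈ ·) hab
  obtain ⟨hat, htb⟩ := (hmem t₀).1 h
  have hua : u a = r := by
    refine le_antisymm ((hmem a).2 ⟨le_rfl, hat.trans htb⟩) ?_
    refine ge_of_tendsto (hu.continuous.continuousWithinAt (s := Set.Iio a) (x := a)) ?_
    filter_upwards [self_mem_nhdsWithin] with t ht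
    exact (not_le.1 fun h' => not_le.2 ht ((hmem t).1 h').1).le
  have hub : u b = r := by
    refine le_antisymm ((hmem b).2 ⟨hat.trans htb, le_rfl⟩) ?_
    refine ge_of_tendsto (hu.continuous.continuousWithinAt (s := Set.Ioi b) (x := b)) ?_
    filter_upwards [self_mem_nhdsWithin] with t ht
    exact (not_le.1 fun h' => not_le.2 ht ((hmem t).1 h').2).le
  have hanti : AntitoneOn u (Set.Icc a t₀) := fun x _ y hy hxy => by
    simpa [hmin x] using
      hc.le_max_of_mem_Icc (Set.mem_univ x) (Set.mem_univ t₀) ⟨hxy, hy.2⟩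
  have hmono : MonotoneOn u (Set.Icc t₀ b) := fun x hx y _ hxy => by
    simpa [hmin y] using
      hc.le_max_of_mem_Icc (Set.mem_univ t₀) (Set.mem_univ y) ⟨hx.1, hxy⟩
  rw [hab, ← restrict_Ioc_eq_restrict_Icc, ← Set.Ioc_union_Ioc_eq_Ioc hat htb,
    lintegral_union measurableSet_Ioc
      (Set.disjoint_left.2 fun t h₁ h₂ => not_le.2 h₂.1 h₁.2),
    lintegral_abs_deriv_of_antitoneOn hu hat hanti, lintegral_abs_deriv_of_monotoneOn hu htb hmono,
    hua, hub, two_mul]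

/-- Orthonormal coordinates adapted to a unit vector `θ`: an isometry onto `θᗮ` for which
`(y, t) ↦ J y + t • θ` preserves volume. -/
lemma exists_isometry_orthogonal {m : ℕ} (θ : EuclideanSpace ℝ (Fin (m + 1))) (hθ : ‖θ‖ = 1) :
    ∃ J : EuclideanSpace ℝ (Fin m) →ₗᵢ[ℝ] EuclideanSpace ℝ (Fin (m + 1)),
      (∀ y, ⟪θ, J y⟫ = 0) ∧ (∀ x, ∃ y, J y = x - ⟪θ, x⟫ • θ) ∧
      MeasurePreserving (fun p : EuclideanSpace ℝ (Fin m) × ℝ => J p.1 + p.2 • θ) := by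
  obtain ⟨b, hb⟩ := Orthonormal.exists_orthonormalBasis_extension_of_card_eq (𝕜 := ℝ)
    (E := EuclideanSpace ℝ (Fin (m + 1))) (ι := Fin (m + 1)) (by simp) (v := fun _ => θ) (s := {0})
    ⟨fun i => by simpa using hθ, fun i j hij => absurd (Subsingleton.elim i j) hij⟩
  have hb0 : b 0 = θ := hb 0 rfl
  let L : EuclideanSpace ℝ (Fin m) →ₗᵢ[ℝ] EuclideanSpace ℝ (Fin (m + 1)) :=
    { toFun := fun y => WithLp.toLp 2 (Fin.cons 0 y.ofLp)
      map_add' := fun x y => by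
        ext i; refine Fin.cases ?_ (fun j => ?_) i <;> simp
      map_smul' := fun c y => by
        ext i; refine Fin.cases ?_ (fun j => ?_) i <;> simp
      norm_map' := fun y => by simp [EuclideanSpace.norm_eq, Fin.sum_univ_succ] }
  have hL : ∀ y, L y = WithLp.toLp 2 (Fin.cons 0 y.ofLp) := fun _ => rfl
  have hrθ : b.repr θ = EuclideanSpace.single 0 1 := by rw [← hb0, b.repr_self]
  refine ⟨b.repr.symm.toLinearIsometry.comp L, fun y => ?_, fun x => ?_, ?_⟩
  · rw [← b.repr.inner_map_map, hrθ]
    suffices (L y) 0 = 0 by simpa [EuclideanSpace.inner_single_left]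
    rfl
  · refine ⟨WithLp.toLp 2 fun i => b.repr x i.succ, b.repr.injective ?_⟩
    have h0 : ⟪θ, x⟫ = b.repr x 0 := by rw [b.repr_apply_apply, hb0]
    rw [map_sub, map_smul, hrθ, h0]
    ext i
    refine Fin.cases ?_ (fun j => ?_) i <;> simp [hL]
  · have h := b.measurePreserving_repr_symm.comp
      ((PiLp.volume_preserving_toLp (Fin (m + 1))).comp
        (((volume_preserving_piFinSuccAbove (fun _ : Fin (m + 1) => ℝ) 0).symm).comp
          ((Measure.measurePreserving_swap (μ := volume) (ν := volume)).comp
            ((PiLp.volume_preserving_ofLp (Fin m)).prod (MeasurePreserving.id volume)))))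
    have hfun : (fun p : EuclideanSpace ℝ (Fin m) × ℝ =>
        b.repr.symm.toLinearIsometry.comp L p.1 + p.2 • θ) =
        b.repr.symm ∘ WithLp.toLp 2 ∘ (MeasurableEquiv.piFinSuccAbove (fun _ => ℝ) 0).symm ∘
          Prod.swap ∘ Prod.map WithLp.ofLp id := by
      ext1 p
      apply b.repr.injective
      simp only [map_add, map_smul, hrθ]
      ext i
      refine Fin.cases ?_ (fun j => ?_) i <;> simp [hL]
    rw [hfun]
    exact h

section Gauge

open scoped Pointwise

variable {F : Type*} [NormedAddCommGroup F] [NormedSpace ℝ F]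

/-- For a closed convex neighbourhood of the origin, sublevel sets of the gauge are dilates. -/
lemma gauge_le_iff_mem_smul {K : Set F} (hK : Convex ℝ K) (hKc : IsClosed K)
    (hK0 : K ∈ nhds 0) {r : ℝ} (hr : 0 < r) {y : F} : gauge K y ≤ r ↔ y ∈ r • K := by
  rw [Set.mem_smul_set_iff_inv_smul_mem₀ hr.ne']
  nth_rewrite 2 [← hKc.closure_eq]
  rw [← gauge_le_one_iff_mem_closure hK hK0, gauge_smul_of_nonneg (inv_nonneg.2 hr.le), smul_eq_mul,
    inv_mul_le_iff₀ hr, mul_one]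

lemma convexOn_gauge {K : Set F} (hK : Convex ℝ K) (hK0 : K ∈ nhds 0) :
    ConvexOn ℝ Set.univ (gauge K) := by
  refine ⟨convex_univ, fun x _ y _ a b ha hb _ => ?_⟩
  refine (gauge_add_le hK (absorbent_nhds_zero hK0) _ _).trans_eq ?_
  rw [gauge_smul_of_nonneg ha, gauge_smul_of_nonneg hb]

lemma lintegral_ofReal_one_sub_gauge [FiniteDimensional ℝ F] [MeasurableSpace F] [BorelSpace F]
    (ν : Measure F) [ν.IsAddHaarMeasure] {K : Set F} (hK : Convex ℝ K) (hKc : IsClosed K)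
    (hK0 : K ∈ nhds 0) :
    ∫⁻ y, ENNReal.ofReal (1 - gauge K y) ∂ν =
      ENNReal.ofReal (1 / (Module.finrank ℝ F + 1)) * ν K := by
  set m := Module.finrank ℝ F
  have hcont : Continuous (gauge K) := continuous_gauge hK hK0
  have hlevel : ∀ t ∈ Set.Ioi (0 : ℝ), ν {y | t ≤ max (1 - gauge K y) 0} =
      (Set.Ioo (0 : ℝ) 1).indicator (fun t => ENNReal.ofReal ((1 - t) ^ m) * ν K) t ∨ t = 1 := by
    intro t ht
    rcases lt_trichotomy t 1 with h1 | h1 | h1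
    · left
      have : {y | t ≤ max (1 - gauge K y) 0} = (1 - t) • K := by
        ext y
        rw [← gauge_le_iff_mem_smul hK hKc hK0 (sub_pos.2 h1)]
        simp only [Set.mem_ofPred_eq, le_max_iff, not_le.2 (Set.mem_Ioi.1 ht), or_false]
        exact le_sub_comm
      rw [this, Measure.addHaar_smul, Set.indicator_of_mem (show t ∈ Set.Ioo (0 : ℝ) 1 from ⟨ht, h1⟩),
        abs_of_nonneg (pow_nonneg (sub_nonneg.2 h1.le) _)]
    · exact .inr h1
    · left
      have : {y | t ≤ max (1 - gauge K y) 0} = ∅ := by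
        ext y
        have := gauge_nonneg (s := K) y
        simp only [Set.mem_ofPred_eq, le_max_iff, not_le.2 (Set.mem_Ioi.1 ht), or_false,
          Set.mem_empty_iff_false, iff_false, not_le]
        linarith
      rw [this, measure_empty, Set.indicator_of_notMem fun h => lt_asymm h1 h.2]
  have hmax : ∀ y, ENNReal.ofReal (1 - gauge K y) = ENNReal.ofReal (max (1 - gauge K y) 0) :=
    fun y => by simp [ENNReal.ofReal, Real.toNNReal]
  simp_rw [hmax]
  rw [lintegral_eq_lintegral_meas_le ν (f := fun y => max (1 - gauge K y) 0)
    (.of_forall fun y => le_max_right _ _)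
    (by fun_prop)]
  have hae : ∀ᵐ t : ℝ, t ≠ 1 := by simp [ae_iff]
  rw [lintegral_congr_ae (g := (Set.Ioo (0 : ℝ) 1).indicator
      fun t => ENNReal.ofReal ((1 - t) ^ m) * ν K)
    (by
      filter_upwards [ae_restrict_mem measurableSet_Ioi, ae_restrict_of_ae hae] with t ht h1
      exact (hlevel t ht).resolve_right h1),
    lintegral_indicator measurableSet_Ioo, Measure.restrict_restrict measurableSet_Ioo,
    Set.inter_eq_left.2 fun t ht => ht.1, lintegral_mul_const _ (by fun_prop),
    restrict_Ioo_eq_restrict_Ioc,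
    ← ofReal_integral_eq_lintegral_ofReal, ← intervalIntegral.integral_of_le zero_le_one]
  · congr 2
    rw [intervalIntegral.integral_comp_sub_left (fun t => t ^ m) 1, integral_pow]
    simp
  · exact (Continuous.integrableOn_Icc (by fun_prop)).mono_set Set.Ioc_subset_Icc_self
  · filter_upwards [ae_restrict_mem measurableSet_Ioc] with t ht
    exact pow_nonneg (sub_nonneg.2 ht.2) _

end Gauge

/-- The shadow of `C` on `θᗮ`, read in isometric coordinates `J`, as an average of the directional
derivatives of the gauge of `C`. -/
lemma exists_shadow_eq_lintegral_lineDeriv_gauge {m : ℕ}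
    {C : Set (EuclideanSpace ℝ (Fin (m + 1)))} (hC : Convex ℝ C) (hCc : IsCompact C)
    (hC0 : C ∈ nhds 0) {θ : EuclideanSpace ℝ (Fin (m + 1))} (hθ : ‖θ‖ = 1) :
    ∃ (J : EuclideanSpace ℝ (Fin m) →ₗᵢ[ℝ] EuclideanSpace ℝ (Fin (m + 1)))
      (S : Set (EuclideanSpace ℝ (Fin m))), J '' S = (fun x => x - ⟪θ, x⟫ • θ) '' C ∧
      ∫⁻ x in C, ENNReal.ofReal |lineDeriv ℝ (gauge C) x θ| =
        2 * (ENNReal.ofReal (1 / (m + 1)) * volume S) := by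
  obtain ⟨J, hJθ, hJ, hmp⟩ := exists_isometry_orthogonal θ hθ
  set Q := ContinuousLinearMap.adjoint J.toContinuousLinearMap
  have hQJ : ∀ y, Q (J y) = y := fun y => ext_inner_right ℝ fun z => by
    rw [ContinuousLinearMap.adjoint_inner_left]
    exact J.inner_map_map y z
  have hQθ : Q θ = 0 := ext_inner_right ℝ fun z => by
    rw [ContinuousLinearMap.adjoint_inner_left, inner_zero_left]
    exact hJθ z
  have hdecomp : ∀ x, J (Q x) = x - ⟪θ, x⟫ • θ := fun x => by
    obtain ⟨y, hy⟩ := hJ x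
    have : Q x = y := by
      rw [← hQJ y, hy, map_sub, map_smul, hQθ, smul_zero, sub_zero]
    rw [this, hy]
  have hQ_line : ∀ y (t : ℝ), Q (J y + t • θ) = y := fun y t => by
    rw [map_add, hQJ, map_smul, hQθ, smul_zero, add_zero]
  have hSconv : Convex ℝ (Q '' C) := hC.linear_image Q.toLinearMap
  have hScomp : IsCompact (Q '' C) := hCc.image Q.continuous
  have hS0 : Q '' C ∈ nhds 0 := by
    simpa using (Q.isOpenMap fun y => ⟨J y, hQJ y⟩).image_mem_nhds hC0
  refine ⟨J, Q '' C, by rw [Set.image_image]; exact Set.image_congr fun x _ => hdecomp x, ?_⟩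
  obtain ⟨L, hL⟩ := hC.lipschitz_gauge hC0
  have hgcont : Continuous (gauge C) := hL.continuous
  have hmem : ∀ x, x ∈ C ↔ gauge C x ≤ 1 := fun x => by
    rw [gauge_le_one_iff_mem_closure hC hC0, hCc.isClosed.closure_eq]
  have hmeas : Measurable (C.indicator fun x => ENNReal.ofReal |lineDeriv ℝ (gauge C) x θ|) := by
    have := measurable_lineDeriv (𝕜 := ℝ) (v := θ) hgcont
    exact Measurable.indicator (by fun_prop) hCc.measurableSet
  have hline : ∀ y, ∫⁻ t : ℝ, C.indicator (fun x => ENNReal.ofReal |lineDeriv ℝ (gauge C) x θ|)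
      (J y + t • θ) = 2 * ENNReal.ofReal (1 - gauge (Q '' C) y) := by
    intro y
    have hlow : ∀ t : ℝ, gauge (Q '' C) y ≤ gauge C (J y + t • θ) := fun t => by
      refine le_of_forall_gt_imp_ge_of_dense fun r hr => ?_
      have hr0 := (gauge_nonneg _).trans_lt hr
      rw [gauge_le_iff_mem_smul hSconv hScomp.isClosed hS0 hr0, ← hQ_line y t]
      obtain ⟨c, hc, hce⟩ := (gauge_le_iff_mem_smul hC hCc.isClosed hC0 hr0).1 hr.le
      exact ⟨Q c, ⟨c, hc, rfl⟩, by rw [← hce]; exact (map_smul Q r c).symm⟩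
    have hatt : ∃ t₀ : ℝ, gauge C (J y + t₀ • θ) = gauge (Q '' C) y := by
      rcases (gauge_nonneg (s := Q '' C) y).eq_or_lt with h | h
      · have : y = 0 := (gauge_eq_zero (absorbent_nhds_zero hS0)
          (NormedSpace.isVonNBounded_of_isBounded ℝ hScomp.isBounded)).1 h.symm
        exact ⟨0, by simp [this, gauge_zero]⟩
      · obtain ⟨_, ⟨c, hc, rfl⟩, hce⟩ :=
          (gauge_le_iff_mem_smul hSconv hScomp.isClosed hS0 h).1 le_rfl
        set r := gauge (Q '' C) y
        refine ⟨⟪θ, r • c⟫, le_antisymm ?_ (hlow _)⟩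
        have hy : y = Q (r • c) := by rw [map_smul]; exact hce.symm
        rw [hy, hdecomp, sub_add_cancel, gauge_le_iff_mem_smul hC hCc.isClosed hC0 h]
        exact Set.smul_mem_smul_set hc
    obtain ⟨t₀, ht₀⟩ := hatt
    have hisom : Isometry fun t : ℝ => J y + t • θ := Isometry.of_dist_eq fun s t => by
      rw [dist_add_left, dist_eq_norm, ← sub_smul, norm_smul, hθ, mul_one, Real.dist_eq,
        Real.norm_eq_abs]
    have hu : LipschitzWith L fun t : ℝ => gauge C (J y + t • θ) := by
      simpa [Function.comp_def] using hL.comp hisom.lipschitz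
    have hc : ConvexOn ℝ Set.univ fun t : ℝ => gauge C (J y + t • θ) := by
      have := (convexOn_gauge hC hC0).comp_affineMap (AffineMap.lineMap (J y) (J y + θ))
      simpa [Function.comp_def, AffineMap.lineMap_apply, add_comm] using this
    have hb : Bornology.IsBounded {t : ℝ | gauge C (J y + t • θ) ≤ 1} := by
      simp_rw [← hmem]
      exact hisom.antilipschitz.isBounded_preimage hCc.isBounded
    have hsub := lintegral_abs_deriv_sublevel hu hc (t₀ := t₀)
      (fun t => ht₀.le.trans (hlow t)) hb
    rw [← ht₀, ← hsub, ← lintegral_indicator (measurableSet_le hu.continuous.measurable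
      measurable_const)]
    refine lintegral_congr fun t => ?_
    have hd : lineDeriv ℝ (gauge C) (J y + t • θ) θ =
        deriv (fun t : ℝ => gauge C (J y + t • θ)) t := by
      rw [lineDeriv]
      simp_rw [add_assoc, ← add_smul]
      rw [deriv_comp_const_add (f := fun s : ℝ => gauge C (J y + s • θ)), add_zero]
    simp only [Set.indicator_apply, Set.mem_ofPred_eq]
    by_cases h : gauge C (J y + t • θ) ≤ 1
    · rw [if_pos h, Set.indicator_of_mem ((hmem _).2 h), hd]
    · rw [if_neg h, Set.indicator_of_notMem fun h' => h ((hmem _).1 h')]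
  rw [← lintegral_indicator hCc.measurableSet, ← hmp.lintegral_comp hmeas, Measure.volume_eq_prod,
    lintegral_prod (fun p : EuclideanSpace ℝ (Fin m) × ℝ =>
      C.indicator (fun x => ENNReal.ofReal |lineDeriv ℝ (gauge C) x θ|) (J p.1 + p.2 • θ))
      (hmeas.comp hmp.measurable).aemeasurable]
  simp_rw [hline]
  rw [lintegral_const_mul _ (by have := continuous_gauge hSconv hS0; fun_prop),
    lintegral_ofReal_one_sub_gauge volume hSconv hScomp.isClosed hS0, finrank_euclideanSpace_fin]

/-- The measure on the unit sphere obtained by pushing `‖∇g‖ dx` forward along `∇g / ‖∇g‖`. -/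
lemma exists_measure_sphere_lintegral_inner {m : ℕ} {L : NNReal}
    {g : EuclideanSpace ℝ (Fin (m + 1)) → ℝ} (hg : LipschitzWith L g)
    (ν : Measure (EuclideanSpace ℝ (Fin (m + 1)))) [IsFiniteMeasure ν] (hν : ν ≪ volume) :
    ∃ μ : Measure (Metric.sphere (0 : EuclideanSpace ℝ (Fin (m + 1))) 1),
      IsFiniteMeasure μ ∧ ∀ θ,
        ∫⁻ φ, ENNReal.ofReal |⟪θ, (φ : EuclideanSpace ℝ (Fin (m + 1)))⟫| ∂μ =
          ∫⁻ x, ENNReal.ofReal |lineDeriv ℝ g x θ| ∂ν := by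
  have hGm : Measurable (gradient g) :=
    (InnerProductSpace.toDual ℝ _).symm.continuous.measurable.comp (measurable_fderiv ℝ g)
  set d : EuclideanSpace ℝ (Fin (m + 1)) → EuclideanSpace ℝ (Fin (m + 1)) := fun x =>
    if gradient g x = 0 then EuclideanSpace.single 0 1 else ‖gradient g x‖⁻¹ • gradient g x
  have hd_norm : ∀ x, d x ∈ Metric.sphere (0 : EuclideanSpace ℝ (Fin (m + 1))) 1 := fun x => by
    by_cases h : gradient g x = 0 <;> simp [d, h, norm_smul]
  have hd_smul : ∀ x, ‖gradient g x‖ • d x = gradient g x := fun x => by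
    by_cases h : gradient g x = 0 <;> simp [d, h, smul_smul]
  have hdm : Measurable d :=
    Measurable.ite (hGm (measurableSet_singleton 0)) measurable_const (by fun_prop)
  have hDm : Measurable fun x => (⟨d x, hd_norm x⟩ : Metric.sphere _ _) := hdm.subtype_mk
  refine ⟨(ν.withDensity fun x => ENNReal.ofReal ‖gradient g x‖).map fun x => ⟨d x, hd_norm x⟩,
    ?_, fun θ => ?_⟩
  · have : IsFiniteMeasure (ν.withDensity fun x => ENNReal.ofReal ‖gradient g x‖) := by
      refine isFiniteMeasure_withDensity (ne_top_of_le_ne_top (b := L * ν Set.univ)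
        (ENNReal.mul_ne_top ENNReal.coe_ne_top (measure_ne_top _ _)) ?_)
      rw [← lintegral_const]
      refine lintegral_mono fun x => ?_
      rw [ENNReal.ofReal_le_iff_le_toReal ENNReal.coe_ne_top, gradient,
        LinearIsometryEquiv.norm_map]
      exact norm_fderiv_le_of_lipschitz ℝ hg
    infer_instance
  · rw [lintegral_map (by fun_prop) hDm, lintegral_withDensity_eq_lintegral_mul _ (by fun_prop)
      (by fun_prop)]
    refine lintegral_congr_ae ?_
    filter_upwards [hν.ae_le hg.ae_differentiableAt] with x hx
    rw [hx.lineDeriv_eq_fderiv, ← toDual_gradient, InnerProductSpace.toDual_apply_apply,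
      Pi.mul_apply, ← ENNReal.ofReal_mul (norm_nonneg _), real_inner_comm θ]
    conv_rhs => rw [← hd_smul x]
    rw [inner_smul_right, abs_mul, abs_norm]

lemma exists_measure_shadow_of_mem_nhds_zero {m : ℕ} {C : Set (EuclideanSpace ℝ (Fin (m + 1)))}
    (hC : Convex ℝ C) (hCc : IsCompact C) (hC0 : C ∈ nhds 0) :
    ∃ μ : Measure (Metric.sphere (0 : EuclideanSpace ℝ (Fin (m + 1))) 1),
      IsFiniteMeasure μ ∧
      ∀ θ : EuclideanSpace ℝ (Fin (m + 1)), ‖θ‖ = 1 →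
        μH[(m : ℝ)] ((fun x => x - ⟪θ, x⟫ • θ) '' C) =
          ∫⁻ φ, ENNReal.ofReal |⟪θ, (φ : EuclideanSpace ℝ (Fin (m + 1)))⟫| ∂μ := by
  obtain ⟨L, hL⟩ := hC.lipschitz_gauge hC0
  have : IsFiniteMeasure (volume.restrict C) := isFiniteMeasure_restrict.2 hCc.measure_ne_top
  obtain ⟨μ, hμ, hμC⟩ := exists_measure_sphere_lintegral_inner hL (volume.restrict C)
    Measure.restrict_le_self.absolutelyContinuous
  have hhaar : (μH[(m : ℝ)] : Measure (EuclideanSpace ℝ (Fin m))).IsAddHaarMeasure := by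
    simpa using isAddHaarMeasure_hausdorffMeasure (E := EuclideanSpace ℝ (Fin m))
  set c := Measure.addHaarScalarFactor (μH[(m : ℝ)] : Measure (EuclideanSpace ℝ (Fin m))) volume
  have hc : (μH[(m : ℝ)] : Measure (EuclideanSpace ℝ (Fin m))) = c • volume :=
    Measure.isAddLeftInvariant_eq_smul _ _
  refine ⟨(c * Real.toNNReal ((m + 1) / 2)) • μ, inferInstance, fun θ hθ => ?_⟩
  obtain ⟨J, S, hJS, hS⟩ := exists_shadow_eq_lintegral_lineDeriv_gauge hC hCc hC0 hθ
  have hconst : ENNReal.ofReal ((m + 1) / 2) * (2 * ENNReal.ofReal (1 / (m + 1))) = 1 := by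
    rw [← ENNReal.ofReal_ofNat 2, ← ENNReal.ofReal_mul (by norm_num),
      ← ENNReal.ofReal_mul (by positivity), ← ENNReal.ofReal_one]
    congr 1
    field_simp
  rw [lintegral_smul_measure, hμC, hS, ← hJS,
    J.isometry.hausdorffMeasure_image (.inl m.cast_nonneg), hc, Measure.smul_apply,
    ENNReal.smul_def, ENNReal.smul_def, smul_eq_mul, smul_eq_mul, ENNReal.coe_mul, mul_assoc,
    ← mul_assoc 2, ← mul_assoc (Real.toNNReal _ : ENNReal)]
  change _ = _ * (ENNReal.ofReal _ * _ * _)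
  rw [hconst, one_mul]

/-- For a convex body `C` in `ℝⁿ`, the shadow function `θ ↦ |P_θ C|` is the
support-type function of a measure: there is a finite Borel measure `μ` on the unit
sphere `S^{n-1}` such that `|P_θ C| = ∫ |⟪θ, φ⟫| dμ(φ)` for every unit vector `θ`. -/
theorem stmt_11 (n : ℕ) (C : Set (EuclideanSpace ℝ (Fin n)))
    (hC : Convex ℝ C) (hCc : IsCompact C) (hCi : (interior C).Nonempty) :
    ∃ μ : Measure (Metric.sphere (0 : EuclideanSpace ℝ (Fin n)) 1),
      IsFiniteMeasure μ ∧
      ∀ θ : EuclideanSpace ℝ (Fin n), ‖θ‖ = 1 →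
        (μH[(n : ℝ) - 1] ((fun x => x - ⟪θ, x⟫ • θ) '' C)).toReal =
          ∫ φ, |⟪θ, (φ : EuclideanSpace ℝ (Fin n))⟫| ∂μ := by
  rcases n with _ | m
  · exact ⟨0, inferInstance, fun θ hθ => by simp [Subsingleton.elim θ 0] at hθ⟩
  obtain ⟨p, hp⟩ := hCi
  have hD0 : (fun x => -p + x) '' C ∈ nhds 0 := by
    have := ((Homeomorph.addLeft (-p)).isOpenMap).image_mem_nhds (mem_interior_iff_mem_nhds.1 hp)
    simpa using this
  obtain ⟨μ, hμ, h⟩ := exists_measure_shadow_of_mem_nhds_zero (hC.translate (-p))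
    (hCc.image (by fun_prop)) hD0
  refine ⟨μ, hμ, fun θ hθ => ?_⟩
  have htrans : (fun x => x - ⟪θ, x⟫ • θ) '' ((fun x => -p + x) '' C) =
      (fun x => (-p - ⟪θ, -p⟫ • θ) + x) '' ((fun x => x - ⟪θ, x⟫ • θ) '' C) := by
    rw [Set.image_image, Set.image_image]
    refine Set.image_congr fun x _ => ?_
    rw [inner_add_right, add_smul]
    abel
  have hθ' := h θ hθ
  rw [htrans, (isometry_add_left _).hausdorffMeasure_image (.inl m.cast_nonneg)] at hθ'
  rw [Nat.cast_succ, add_sub_cancel_right, hθ', integral_eq_lintegral_of_nonneg_ae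
    (.of_forall fun _ => abs_nonneg _) (by fun_prop)]
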